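/- arXiv:2310.00237 — 3 statements merged into one kernel-verified Lean document; each statement's English description precedes it below -/
import Mathlib

section
/- Let 𝐆 be a group, F : 𝐆 → 𝐆 a group endomorphism, G = 𝐆^F, and ℒ the Lang map. Let D ≤ 𝐆 be a subgroup with Z(D) ≤ Z(𝐆), and suppose every element of Z(D) is of the form d⁻¹F(d) for some d ∈ D (the conclusion of the Lang–Steinberg theorem for D). Then ℒ⁻¹(Z(D)) = G · (D ∩ ℒ⁻¹(Z(D))). Moreover, if G and Z(D) are finite then ℒ⁻¹(Z(D)) is a finite subgroup of 𝐆 containing G. (Abstract form of Lemma 3.2(ii), where D is the derived subgroup of a connected reductive group 𝐆.) -/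
/-- The subgroup of fixed points of a group endomorphism `F`. -/
def fixedSubgroup {G : Type*} [Group G] (F : G →* G) : Subgroup G where
  carrier := {g | F g = g}
  one_mem' := by simp
  mul_mem' := by
    intro a b ha hb
    simp only [Set.mem_setOf_eq, map_mul] at *
    rw [ha, hb]
  inv_mem' := by
    intro a ha
    simp only [Set.mem_setOf_eq, map_inv] at *
    rw [ha]

/-- The center of a subgroup `D`, viewed as a subset of the ambient group. -/
def subgroupCenterSet {G : Type*} [Group G] (D : Subgroup G) : Set G :=
  {d : G | d ∈ D ∧ ∀ d' ∈ D, d * d' = d' * d}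

theorem coe_map_center_eq_subgroupCenterSet {G : Type*} [Group G] (D : Subgroup G) :
    (((Subgroup.center D).map D.subtype : Subgroup G) : Set G) = subgroupCenterSet D := by
  ext z
  simp only [Subgroup.coe_map, Subgroup.coe_subtype, Set.mem_image, SetLike.mem_coe,
    Subgroup.mem_center_iff, subgroupCenterSet, Set.mem_ofPred_eq]
  constructor
  · rintro ⟨d, hd, rfl⟩
    exact ⟨d.2, fun d' hd' => congrArg Subtype.val (hd ⟨d', hd'⟩).symm⟩
  · rintro ⟨hz, hcomm⟩
    exact ⟨⟨z, hz⟩, fun d => Subtype.ext (hcomm d d.2).symm, rfl⟩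

/-- The preimage of a central subgroup under the Lang map `g ↦ g⁻¹ * F g`. -/
def langPreimage {G : Type*} [Group G] (F : G →* G) (Z : Subgroup G)
    (hZ : Z ≤ Subgroup.center G) : Subgroup G where
  carrier := {g | g⁻¹ * F g ∈ Z}
  one_mem' := by simp
  mul_mem' := by
    intro a b ha hb
    have hcomm : b⁻¹ * (a⁻¹ * F a) = a⁻¹ * F a * b⁻¹ := Subgroup.mem_center_iff.mp (hZ ha) b⁻¹
    have h : (a * b)⁻¹ * F (a * b) = a⁻¹ * F a * (b⁻¹ * F b) := by
      rw [← mul_assoc (a⁻¹ * F a), ← hcomm, map_mul]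
      group
    rw [Set.mem_ofPred_eq, h]
    exact Z.mul_mem ha hb
  inv_mem' := by
    intro a ha
    have hcomm : a * (a⁻¹ * F a)⁻¹ = (a⁻¹ * F a)⁻¹ * a :=
      Subgroup.mem_center_iff.mp (hZ (Z.inv_mem ha)) a
    have h : a⁻¹⁻¹ * F a⁻¹ = (a⁻¹ * F a)⁻¹ := by
      calc a⁻¹⁻¹ * F a⁻¹ = a * (a⁻¹ * F a)⁻¹ * a⁻¹ := by rw [map_inv]; group
        _ = (a⁻¹ * F a)⁻¹ := by rw [hcomm, mul_inv_cancel_right]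
    rw [Set.mem_ofPred_eq, h]
    exact Z.inv_mem ha

theorem mul_inv_mem_fixedSubgroup {G : Type*} [Group G] (F : G →* G) {g d : G}
    (h : d⁻¹ * F d = g⁻¹ * F g) : g * d⁻¹ ∈ fixedSubgroup F := by
  change F (g * d⁻¹) = g * d⁻¹
  have hd : F d = d * (g⁻¹ * F g) := by rw [← h, mul_inv_cancel_left]
  rw [map_mul, map_inv, hd]
  group

theorem finite_setOf_lang_eq {G : Type*} [Group G] (F : G →* G)
    (hF : (fixedSubgroup F : Set G).Finite) (z : G) : {g : G | g⁻¹ * F g = z}.Finite := by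
  rcases Set.eq_empty_or_nonempty {g : G | g⁻¹ * F g = z} with h | ⟨d, hd⟩
  · rw [h]
    exact Set.finite_empty
  · refine (hF.image (· * d)).subset fun g hg => ⟨g * d⁻¹, ?_, inv_mul_cancel_right g d⟩
    exact mul_inv_mem_fixedSubgroup F (hd.trans hg.symm)

/-- abstract form of Lemma 3.2(ii): if `Z(D) ≤ Z(G)` and every element of
`Z(D)` is of the form `d⁻¹ * F d` with `d ∈ D`, then `ℒ⁻¹(Z(D)) = G^F · (D ∩ ℒ⁻¹(Z(D)))`;
moreover if `G^F` and `Z(D)` are finite then `ℒ⁻¹(Z(D))` is a finite subgroup containing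
`G^F`. -/
theorem lang_preimage_center_of_subgroup {G : Type*} [Group G] (F : G →* G) (D : Subgroup G)
    (hZD : subgroupCenterSet D ⊆ (Subgroup.center G : Set G))
    (hLang : ∀ z ∈ subgroupCenterSet D, ∃ d ∈ D, d⁻¹ * F d = z) :
    ({g : G | g⁻¹ * F g ∈ subgroupCenterSet D} =
      {g : G | ∃ x d : G, x ∈ fixedSubgroup F ∧ d ∈ D ∧
        d⁻¹ * F d ∈ subgroupCenterSet D ∧ g = x * d}) ∧
    (((fixedSubgroup F : Subgroup G) : Set G).Finite → (subgroupCenterSet D).Finite →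
      ∃ X : Subgroup G, (X : Set G) = {g : G | g⁻¹ * F g ∈ subgroupCenterSet D} ∧
        (X : Set G).Finite ∧ fixedSubgroup F ≤ X) := by
  refine ⟨?_, fun hF hZ => ?_⟩
  · ext g
    constructor
    · intro hg
      obtain ⟨d, hdD, hd⟩ := hLang _ hg
      exact ⟨g * d⁻¹, d, mul_inv_mem_fixedSubgroup F hd, hdD, hd ▸ hg,
        (inv_mul_cancel_right g d).symm⟩
    · rintro ⟨x, d, hx, -, hd, rfl⟩
      have hx : F x = x := hx
      have h : (x * d)⁻¹ * F (x * d) = d⁻¹ * F d := by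
        rw [map_mul, hx]
        group
      rwa [Set.mem_ofPred_eq, h]
  · rw [← coe_map_center_eq_subgroupCenterSet] at hZD hZ ⊢
    refine ⟨langPreimage F _ hZD, rfl,
      Set.Finite.preimage' (f := fun g => g⁻¹ * F g) hZ fun z _ => finite_setOf_lang_eq F hF z, fun g hg => ?_⟩
    have hg : F g = g := hg
    change g⁻¹ * F g ∈ (Subgroup.center D).map D.subtype
    rw [hg, inv_mul_cancel]
    exact one_mem _
end

section
/- Let M be a group, A ≤ M a finite subgroup, and C ≤ Z(M) a central subgroup such that M = A·C (every element of M is a product of an element of A and an element of C). Then every finite subgroup X ≤ M is contained in A·Z for some finite subgroup Z ≤ C. (Abstract form of Lemma 3.2(iii), where M = N_𝐆(G), A = N_{𝐆_der}(G) and C = C_𝐆(G) = Z(𝐆).) -/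
open scoped IsMulCommutative

/-- In a commutative group, finitely many elements of finite order generate a finite subgroup. -/
theorem Subgroup.finite_closure_of_isOfFinOrder {G : Type*} [CommGroup G] {s : Set G}
    (hs : s.Finite) (h : ∀ x ∈ s, IsOfFinOrder x) : Finite (Subgroup.closure s) := by
  have : Finite s := hs
  have hle : Subgroup.closure s ≤ CommGroup.torsion G := (Subgroup.closure_le _).2 h
  refine CommGroup.finite_of_fg_isMulTorsion _ fun x => ?_
  exact Submonoid.isOfFinOrder_coe.1 (hle x.2)

/-- abstract form of Lemma 3.2(iii): if `M = A·C` with `A` a finite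
subgroup and `C` a central subgroup, then every finite subgroup `X ≤ M` is contained in
`A·Z` for some finite subgroup `Z ≤ C`. -/
theorem finite_subgroup_le_mul_of_central_complement {M : Type*} [Group M]
    (A C : Subgroup M) (hA : (A : Set M).Finite) (hC : C ≤ Subgroup.center M)
    (hM : ∀ m : M, ∃ a ∈ A, ∃ c ∈ C, m = a * c) :
    ∀ X : Subgroup M, (X : Set M).Finite →
      ∃ Z : Subgroup M, Z ≤ C ∧ (Z : Set M).Finite ∧
        ∀ x ∈ X, ∃ a ∈ A, ∃ z ∈ Z, x = a * z := by
  intro X hX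
  have isOfFinOrder_of_mem {H : Subgroup M} (hH : (H : Set M).Finite) {g : M} (hg : g ∈ H) :
      IsOfFinOrder g := by
    have : Finite H := hH
    exact Submonoid.isOfFinOrder_coe.2 (isOfFinOrder_of_finite (⟨g, hg⟩ : H))
  choose a ha c hc hac using hM
  let c' : M → Subgroup.center M := fun x => ⟨c x, hC (hc x)⟩
  have hfin : Finite (Subgroup.closure (c' '' X)) := by
    refine Subgroup.finite_closure_of_isOfFinOrder (hX.image c') ?_
    rintro _ ⟨x, hx, rfl⟩
    refine Submonoid.isOfFinOrder_coe.1 (?_ : IsOfFinOrder (c x))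
    have hcomm : Commute (a x)⁻¹ x := by
      have h : Commute (a x) (a x * c x) :=
        (Commute.refl _).mul_right (Subgroup.mem_center_iff.1 (hC (hc x)) (a x))
      rw [← hac x] at h
      exact h.inv_left
    rw [eq_inv_mul_of_mul_eq (hac x).symm]
    exact hcomm.isOfFinOrder_mul (isOfFinOrder_of_mem hA (ha x)).inv (isOfFinOrder_of_mem hX hx)
  refine ⟨(Subgroup.closure (c' '' X)).map (Subgroup.center M).subtype, ?_, ?_, ?_⟩
  · rw [Subgroup.map_le_iff_le_comap, Subgroup.closure_le]
    rintro _ ⟨x, -, rfl⟩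
    exact hc x
  · rw [Subgroup.coe_map]
    exact Set.Finite.image _ hfin
  · intro x hx
    exact ⟨a x, ha x, c x,
      Subgroup.mem_map_of_mem (Subgroup.center M).subtype
        (Subgroup.subset_closure (Set.mem_image_of_mem c' hx)), hac x⟩
end

section
/- Let 𝐆 = 𝐆₁ × ⋯ × 𝐆ₙ be a direct product of groups and F an automorphism of 𝐆 with F(𝐆ᵢ) = 𝐆ᵢ₊₁ for all i (indices mod n), so that Fⁿ(𝐆₁) = 𝐆₁. Then: (a) the projection π : 𝐆 → 𝐆₁ restricts to a group isomorphism from 𝐆^F onto 𝐆₁^{Fⁿ}, whose inverse sends h to hF(h)⋯F^{n-1}(h); and (b) π restricts to a surjective homomorphism from {g ∈ 𝐆 : g⁻¹F(g) ∈ Z(𝐆)} onto {h ∈ 𝐆₁ : h⁻¹Fⁿ(h) ∈ Z(𝐆₁)}. (This is the reduction step in the proof of Proposition 3.4.) -/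
/-- The `i`-th factor of a direct product `∀ j, K j`, viewed as a subgroup: elements that are
trivial in every coordinate other than `i`. -/
def piFactor {n : ℕ} (K : Fin n → Type*) [∀ i, Group (K i)] (i : Fin n) :
    Subgroup (∀ j, K j) where
  carrier := {g | ∀ j, j ≠ i → g j = 1}
  one_mem' := fun j _ => rfl
  mul_mem' := by
    intro a b ha hb j hj
    simp [Pi.mul_apply, ha j hj, hb j hj]
  inv_mem' := by
    intro a ha j hj
    simp [Pi.inv_apply, ha j hj]

theorem List.prod_map_range_eq_ite {M : Type*} [Monoid M] (f : ℕ → M) (j : ℕ)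
    (hf : ∀ k, k ≠ j → f k = 1) (m : ℕ) :
    ((List.range m).map f).prod = if j < m then f j else 1 := by
  induction m with
  | zero => simp
  | succ m ih =>
    rw [List.range_succ, List.map_append, List.prod_append, ih]
    rcases lt_trichotomy j m with h | h | h
    · simp [h, hf m h.ne', h.trans (Nat.lt_succ_self m)]
    · subst h; simp
    · simp [h.not_gt, hf m h.ne, show ¬ j < m + 1 by omega]

theorem Fin.ofNat_succ_eq_add_one (n : ℕ) [NeZero n] (k : ℕ) :
    Fin.ofNat n (k + 1) = Fin.ofNat n k + 1 := by
  apply Fin.ext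
  simp [Fin.ofNat, Fin.val_add]

theorem mulSingle_mem_piFactor {n : ℕ} {K : Fin n → Type*} [∀ i, Group (K i)] (i : Fin n)
    (h : K i) : Pi.mulSingle i h ∈ piFactor K i :=
  fun _ hj => Pi.mulSingle_eq_of_ne hj h

section CyclicFactors

variable {n : ℕ} [NeZero n] {K : Fin n → Type*} [∀ i, Group (K i)]
  {F : MulAut (∀ i, K i)}
  (hF : ∀ i : Fin n, Subgroup.map F.toMonoidHom (piFactor K i) = piFactor K (i + 1))

include hF

theorem apply_mem_piFactor_add_one {i : Fin n} {x : ∀ i, K i} (hx : x ∈ piFactor K i) :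
    F x ∈ piFactor K (i + 1) := by
  rw [← hF]
  exact Subgroup.mem_map_of_mem _ hx

theorem apply_apply_add_one (i : Fin n) (x : ∀ i, K i) :
    F x (i + 1) = F (Pi.mulSingle i (x i)) (i + 1) := by
  have key : (Pi.evalMonoidHom K (i + 1)).comp F.toMonoidHom =
      ((Pi.evalMonoidHom K (i + 1)).comp F.toMonoidHom).comp
        ((MonoidHom.mulSingle K i).comp (Pi.evalMonoidHom K i)) := by
    refine MonoidHom.pi_ext fun j y => ?_
    change F (Pi.mulSingle j y) (i + 1) = F (Pi.mulSingle i (Pi.mulSingle j y i)) (i + 1)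
    by_cases hj : j = i
    · subst hj; simp
    · rw [Pi.mulSingle_eq_of_ne (Ne.symm hj), Pi.mulSingle_one, map_one]
      exact apply_mem_piFactor_add_one hF (mulSingle_mem_piFactor j y) _
        fun h => hj (add_right_cancel h).symm
  exact DFunLike.congr_fun key x

theorem apply_add_one_congr {i : Fin n} {x y : ∀ i, K i} (hxy : x i = y i) :
    F x (i + 1) = F y (i + 1) := by
  rw [apply_apply_add_one hF, hxy, ← apply_apply_add_one hF]

theorem pow_apply_ofNat_congr {x y : ∀ i, K i} (hxy : x 0 = y 0) (k : ℕ) :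
    (F ^ k) x (Fin.ofNat n k) = (F ^ k) y (Fin.ofNat n k) := by
  induction k with
  | zero => exact hxy
  | succ k ih =>
    rw [Fin.ofNat_succ_eq_add_one, pow_succ', MulAut.mul_apply, MulAut.mul_apply]
    exact apply_add_one_congr hF ih

theorem pow_mulSingle_mem_piFactor (h : K 0) (k : ℕ) :
    (F ^ k) (Pi.mulSingle 0 h) ∈ piFactor K (Fin.ofNat n k) := by
  induction k with
  | zero => exact mulSingle_mem_piFactor 0 h
  | succ k ih =>
    rw [Fin.ofNat_succ_eq_add_one, pow_succ', MulAut.mul_apply]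
    exact apply_mem_piFactor_add_one hF ih

theorem pow_card_mulSingle (h : K 0) :
    (F ^ n) (Pi.mulSingle 0 h) = Pi.mulSingle 0 ((F ^ n) (Pi.mulSingle 0 h) 0) := by
  have hmem := pow_mulSingle_mem_piFactor hF h n
  rw [show Fin.ofNat n n = 0 by apply Fin.ext; simp [Fin.ofNat]] at hmem
  funext j
  by_cases hj : j = 0
  · subst hj; simp
  · rw [hmem j hj, Pi.mulSingle_eq_of_ne hj]

theorem pow_card_apply_zero (x : ∀ i, K i) :
    (F ^ n) (Pi.mulSingle 0 (x 0)) 0 = (F ^ n) x 0 := by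
  have h := pow_apply_ofNat_congr hF (x := Pi.mulSingle 0 (x 0)) (y := x) (by simp) n
  rwa [show Fin.ofNat n n = 0 by apply Fin.ext; simp [Fin.ofNat]] at h

theorem orbit_prod_apply (h : K 0) (j : Fin n) :
    ((List.range n).map (fun k => (F ^ k) (Pi.mulSingle 0 h))).prod j =
      (F ^ (j : ℕ)) (Pi.mulSingle 0 h) j := by
  -- factors of index `k ≥ n` do not occur, so they may be replaced by `1`
  have hlist : (List.range n).map (fun k => (F ^ k) (Pi.mulSingle 0 h) j) =
      (List.range n).map (fun k => if k < n then (F ^ k) (Pi.mulSingle 0 h) j else 1) :=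
    List.map_congr_left fun k hk => by simp [List.mem_range.1 hk]
  rw [Pi.list_prod_apply, List.map_map]
  change ((List.range n).map (fun k => (F ^ k) (Pi.mulSingle 0 h) j)).prod = _
  rw [hlist, List.prod_map_range_eq_ite _ (j : ℕ)]
  · simp
  · intro k hk
    split_ifs with hkn
    · refine pow_mulSingle_mem_piFactor hF h k j fun hj => hk ?_
      simp [hj, Fin.ofNat, Nat.mod_eq_of_lt hkn]
    · rfl

theorem orbit_prod_apply_zero (h : K 0) :
    ((List.range n).map (fun k => (F ^ k) (Pi.mulSingle 0 h))).prod 0 = h := by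
  simp [orbit_prod_apply hF]

theorem inv_orbit_prod_mul_apply (h : K 0) :
    (((List.range n).map (fun k => (F ^ k) (Pi.mulSingle 0 h))).prod)⁻¹ *
        F ((List.range n).map (fun k => (F ^ k) (Pi.mulSingle 0 h))).prod =
      Pi.mulSingle 0 (h⁻¹ * (F ^ n) (Pi.mulSingle 0 h) 0) := by
  set P := ((List.range n).map (fun k => (F ^ k) (Pi.mulSingle 0 h))).prod with hP
  have step (j : Fin n) : F P (j + 1) = (F ^ ((j : ℕ) + 1)) (Pi.mulSingle 0 h) (j + 1) := by
    rw [pow_succ', MulAut.mul_apply]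
    exact apply_add_one_congr hF (orbit_prod_apply hF h j)
  funext i
  obtain ⟨j, rfl⟩ : ∃ j, i = j + 1 := ⟨i - 1, by simp⟩
  rw [Pi.mul_apply, Pi.inv_apply, step]
  rcases Nat.lt_or_ge ((j : ℕ) + 1) n with hj | hj
  · have hval : ((j + 1 : Fin n) : ℕ) = j + 1 := by
      simp [Fin.val_add, Nat.mod_eq_of_lt hj]
    have hne : j + 1 ≠ 0 := fun h0 => by simp [h0] at hval
    rw [Pi.mulSingle_eq_of_ne hne, hP, orbit_prod_apply hF, hval, inv_mul_cancel]
  · have hjn : (j : ℕ) + 1 = n := by omega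
    have h0 : j + 1 = 0 := by
      apply Fin.ext
      simp [Fin.val_add, hjn]
    rw [hjn, h0, Pi.mulSingle_eq_same, hP, orbit_prod_apply_zero hF]

end CyclicFactors

theorem Subgroup.inv_mul_pow_apply_mem_center {G : Type*} [Group G] (F : MulAut G) {g : G}
    (hg : g⁻¹ * F g ∈ Subgroup.center G) (k : ℕ) : g⁻¹ * (F ^ k) g ∈ Subgroup.center G := by
  induction k with
  | zero => simp
  | succ k ih =>
    have hmap : F (g⁻¹ * (F ^ k) g) ∈ Subgroup.center G := by
      rw [← Subgroup.characteristic_iff_map_eq.1 Subgroup.centerCharacteristic F]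
      exact Subgroup.mem_map_of_mem _ ih
    have h := Subgroup.mul_mem _ hg hmap
    rwa [map_mul, map_inv, mul_assoc, mul_inv_cancel_left, ← MulAut.mul_apply, ← pow_succ'] at h

theorem Subgroup.apply_mem_center_of_mem_center_pi {ι : Type*} [DecidableEq ι] {K : ι → Type*}
    [∀ i, Group (K i)] {z : ∀ i, K i} (hz : z ∈ Subgroup.center (∀ i, K i)) (i : ι) :
    z i ∈ Subgroup.center (K i) :=
  Subgroup.mem_center_iff.2 fun c => by
    simpa using congrFun (Subgroup.mem_center_iff.1 hz (Pi.mulSingle i c)) i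

theorem Subgroup.mulSingle_mem_center_pi {ι : Type*} [DecidableEq ι] {K : ι → Type*}
    [∀ i, Group (K i)] {i : ι} {z : K i} (hz : z ∈ Subgroup.center (K i)) :
    Pi.mulSingle i z ∈ Subgroup.center (∀ i, K i) :=
  Subgroup.mem_center_iff.2 fun g => by
    funext j
    by_cases hj : j = i
    · subst hj
      simpa using Subgroup.mem_center_iff.1 hz (g j)
    · simp [Pi.mulSingle_eq_of_ne hj]

/-- the reduction step in the proof of Proposition 3.4: if `F` is an
automorphism of a direct product `𝐆 = 𝐆₀ × ⋯ × 𝐆_{n-1}` cyclically permuting the factors,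
then (a) the projection to the first factor restricts to a bijection (necessarily a group
isomorphism) from `𝐆^F` onto `𝐆₀^{Fⁿ}`, with inverse `h ↦ h·F(h)···F^{n-1}(h)`; and
(b) the projection maps `{g : g⁻¹F(g) ∈ Z(𝐆)}` into and onto
`{h : h⁻¹Fⁿ(h) ∈ Z(𝐆₀)}`. -/
theorem projection_of_cyclic_factors (n : ℕ) [NeZero n] (K : Fin n → Type*)
    [∀ i, Group (K i)] (F : MulAut (∀ i, K i))
    (hF : ∀ i : Fin n, Subgroup.map F.toMonoidHom (piFactor K i) = piFactor K (i + 1)) :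
    (Set.BijOn (fun g : ∀ i, K i => g 0) {g : ∀ i, K i | F g = g}
      {h : K 0 | (F ^ n) (Pi.mulSingle 0 h) = Pi.mulSingle 0 h}) ∧
    (∀ h : K 0, (F ^ n) (Pi.mulSingle 0 h) = Pi.mulSingle 0 h →
      (((List.range n).map (fun k => (F ^ k) (Pi.mulSingle 0 h))).prod
          ∈ {g : ∀ i, K i | F g = g} ∧
        ((List.range n).map (fun k => (F ^ k) (Pi.mulSingle 0 h))).prod 0 = h)) ∧
    (Set.MapsTo (fun g : ∀ i, K i => g 0)
      {g : ∀ i, K i | g⁻¹ * F g ∈ Subgroup.center (∀ i, K i)}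
      {h : K 0 | h⁻¹ * (F ^ n) (Pi.mulSingle 0 h) 0 ∈ Subgroup.center (K 0)} ∧
     Set.SurjOn (fun g : ∀ i, K i => g 0)
      {g : ∀ i, K i | g⁻¹ * F g ∈ Subgroup.center (∀ i, K i)}
      {h : K 0 | h⁻¹ * (F ^ n) (Pi.mulSingle 0 h) 0 ∈ Subgroup.center (K 0)}) := by
  have fixed (h : K 0) (hh : (F ^ n) (Pi.mulSingle 0 h) = Pi.mulSingle 0 h) :
      F ((List.range n).map (fun k => (F ^ k) (Pi.mulSingle 0 h))).prod =
        ((List.range n).map (fun k => (F ^ k) (Pi.mulSingle 0 h))).prod := by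
    have key := inv_orbit_prod_mul_apply hF h
    rw [hh, Pi.mulSingle_eq_same, inv_mul_cancel, Pi.mulSingle_one] at key
    exact (inv_mul_eq_one.1 key).symm
  have pow_fixed {g : ∀ i, K i} (hg : F g = g) (k : ℕ) : (F ^ k) g = g := by
    induction k with
    | zero => simp
    | succ k ih => rw [pow_succ', MulAut.mul_apply, ih, hg]
  refine ⟨⟨fun g hg => ?_, fun g hg g' hg' h0 => ?_, fun h hh => ?_⟩, fun h hh => ?_,
    fun g hg => ?_, fun h hh => ?_⟩
  · change (F ^ n) (Pi.mulSingle 0 (g 0)) = Pi.mulSingle 0 (g 0)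
    rw [pow_card_mulSingle hF, pow_card_apply_zero hF, pow_fixed hg]
  · funext j
    have h := pow_apply_ofNat_congr hF h0 j
    rwa [pow_fixed hg, pow_fixed hg', Fin.ofNat_val_eq_self] at h
  · exact ⟨_, fixed h hh, orbit_prod_apply_zero hF h⟩
  · exact ⟨fixed h hh, orbit_prod_apply_zero hF h⟩
  · change (g 0)⁻¹ * (F ^ n) (Pi.mulSingle 0 (g 0)) 0 ∈ Subgroup.center (K 0)
    rw [pow_card_apply_zero hF]
    exact Subgroup.apply_mem_center_of_mem_center_pi
      (Subgroup.inv_mul_pow_apply_mem_center F hg n) 0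
  · refine ⟨_, ?_, orbit_prod_apply_zero hF h⟩
    rw [Set.mem_ofPred_eq, inv_orbit_prod_mul_apply hF]
    exact Subgroup.mulSingle_mem_center_pi hh
end
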